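/- arXiv:2006.01024 — 9 statements merged into one kernel-verified Lean document; each statement's English description precedes it below -/
import Mathlib

section
/- Let (X,d) be a metric space with a Borel measure μ, let x₀ ∈ X, n ∈ ℕ, R > 0 and ε₀ > 0. Assume that μ(B(y,ρ)) ≥ ε₀·ρⁿ for every y ∈ B(x₀,R) and every ρ ∈ (0,1], and that μ(B(x₀,R+1)) < ∞. Then the ball B(x₀,R) is totally bounded. -/
open MeasureTheory Metric Set

/-- A set that is not totally bounded contains an infinite uniformly separated sequence. -/
theorem exists_separated_seq_of_not_totallyBounded {X : Type*} [PseudoMetricSpace X] {s : Set X}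
    (hs : ¬ TotallyBounded s) :
    ∃ δ > 0, ∃ f : ℕ → X, (∀ k, f k ∈ s) ∧ Pairwise fun i j ↦ δ ≤ dist (f i) (f j) := by
  rw [Metric.totallyBounded_iff] at hs
  push Not at hs
  obtain ⟨δ, hδ, h⟩ := hs
  have : Std.Symm fun x y : X ↦ δ ≤ dist x y := ⟨fun x y hxy ↦ by rwa [dist_comm]⟩
  refine ⟨δ, hδ, exists_seq_of_forall_finset_exists' (· ∈ s) (fun x y ↦ δ ≤ dist x y) ?_⟩
  intro t _
  obtain ⟨y, hys, hy⟩ := not_subset.1 (h t t.finite_toSet)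
  refine ⟨y, hys, fun x hx ↦ ?_⟩
  by_contra! hlt
  exact hy (mem_biUnion hx (by rwa [mem_ball, dist_comm]))

/-- A uniform lower volume bound `μ(B(y,ρ)) ≥ ε₀ ρⁿ` for all small balls centered in `B(x₀,R)`,
together with a finite upper bound on `μ(B(x₀,R+1))`, forces the ball `B(x₀,R)` to be
totally bounded. -/
theorem stmt_1 {X : Type*} [MetricSpace X] [MeasurableSpace X] [BorelSpace X]
    (μ : Measure X) (x₀ : X) (n : ℕ) (R ε₀ : ℝ) (hR : 0 < R) (hε₀ : 0 < ε₀)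
    (hlow : ∀ y ∈ ball x₀ R, ∀ ρ ∈ Set.Ioc (0 : ℝ) 1,
      ENNReal.ofReal (ε₀ * ρ ^ n) ≤ μ (ball y ρ))
    (hfin : μ (ball x₀ (R + 1)) < ⊤) :
    TotallyBounded (ball x₀ R) := by
  by_contra hs
  obtain ⟨δ, hδ, f, hf, hsep⟩ := exists_separated_seq_of_not_totallyBounded hs
  obtain ⟨ρ, hρ, hρ1, hρδ⟩ : ∃ ρ : ℝ, 0 < ρ ∧ ρ ≤ 1 ∧ ρ ≤ δ / 2 :=
    ⟨min 1 (δ / 2), by positivity, min_le_left _ _, min_le_right _ _⟩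
  have hunion : ⋃ k, ball (f k) ρ ⊆ ball x₀ (R + 1) :=
    iUnion_subset fun k ↦ ball_subset_ball' (by linarith [mem_ball.1 (hf k)])
  have hfinite := Measure.finite_const_le_meas_of_disjoint_iUnion μ
    (ENNReal.ofReal_pos.2 (by positivity : 0 < ε₀ * ρ ^ n))
    (fun k ↦ measurableSet_ball (x := f k) (ε := ρ))
    (fun i j hij ↦ ball_disjoint_ball (by linarith [hsep hij]))
    ((measure_mono hunion).trans_lt hfin).ne
  exact infinite_univ (hfinite.subset fun k _ ↦ hlow (f k) (hf k) ρ ⟨hρ, hρ1⟩)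
end

section
/- Let (X_k, d_k, x_k), k ∈ ℕ, be pointed metric spaces with Borel measures μ_k, and let (X, d, x) be a pointed metric space with a Borel measure μ. Let ε_k > 0 with ε_k → 0, and let f_k : X_k → X be Borel measurable maps such that |d(f_k(a), f_k(b)) − d_k(a,b)| ≤ ε_k for all a, b ∈ X_k and d(f_k(x_k), x) ≤ ε_k. Assume that for every open set U ⊆ X one has μ(U) ≤ liminf_k μ_k(f_k⁻¹(U)), and for every bounded closed set C ⊆ X one has limsup_k μ_k(f_k⁻¹(C)) ≤ μ(C). Then for all radii 0 < r₁ < r₂ < r₃ one has limsup_{k → ∞} μ_k(B(x_k, r₁)) ≤ μ(B(x, r₂)) ≤ liminf_{k → ∞} μ_k(B(x_k, r₃)). -/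
open MeasureTheory Metric Set Filter

/-- An `ε`-isometry sending `p` to within `ε` of `y` distorts distances to the base point by at
most `2 * ε`. -/
lemma abs_dist_sub_dist_le_two_mul {X Y : Type*} [PseudoMetricSpace X] [PseudoMetricSpace Y]
    {f : X → Y} {ε : ℝ} {p : X} {y : Y} (hiso : ∀ a b, |dist (f a) (f b) - dist a b| ≤ ε)
    (hpt : dist (f p) y ≤ ε) (a : X) : |dist (f a) y - dist a p| ≤ 2 * ε := by
  have hap := abs_le.1 (hiso a p)
  have hle := dist_triangle (f a) (f p) y
  have hge := dist_triangle_right (f a) (f p) y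
  rw [abs_le]
  constructor <;> linarith

/-- Lemma 3.3 ('LemmaMeasBalls'): if `(X_k, d_k, μ_k, x_k)` converges to `(X, d, μ, x)` in
the pointed measured Gromov--Hausdorff sense (expressed via `ε_k`-isometries `f_k` whose
pushforward measures converge weakly, stated through the portmanteau inequalities), then
`limsup_k μ_k(B(x_k,r₁)) ≤ μ(B(x,r₂)) ≤ liminf_k μ_k(B(x_k,r₃))` for `0 < r₁ < r₂ < r₃`. -/
theorem stmt_2 {X : ℕ → Type*} [∀ k, MetricSpace (X k)] [∀ k, MeasurableSpace (X k)]
    [∀ k, BorelSpace (X k)]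
    {Y : Type*} [MetricSpace Y] [MeasurableSpace Y] [BorelSpace Y]
    (μk : ∀ k, Measure (X k)) (μ : Measure Y) (xk : ∀ k, X k) (x : Y)
    (ε : ℕ → ℝ) (hεpos : ∀ k, 0 < ε k) (hε0 : Tendsto ε atTop (nhds 0))
    (f : ∀ k, X k → Y) (hmeas : ∀ k, Measurable (f k))
    (hiso : ∀ k, ∀ a b : X k, |dist (f k a) (f k b) - dist a b| ≤ ε k)
    (hpt : ∀ k, dist (f k (xk k)) x ≤ ε k)
    (hopen : ∀ U : Set Y, IsOpen U →
      μ U ≤ liminf (fun k => μk k (f k ⁻¹' U)) atTop)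
    (hclosed : ∀ C : Set Y, IsClosed C → Bornology.IsBounded C →
      limsup (fun k => μk k (f k ⁻¹' C)) atTop ≤ μ C)
    (r₁ r₂ r₃ : ℝ) (h1 : 0 < r₁) (h12 : r₁ < r₂) (h23 : r₂ < r₃) :
    limsup (fun k => μk k (ball (xk k) r₁)) atTop ≤ μ (ball x r₂) ∧
      μ (ball x r₂) ≤ liminf (fun k => μk k (ball (xk k) r₃)) atTop := by
  have hdist k a := abs_le.1 (abs_dist_sub_dist_le_two_mul (hiso k) (hpt k) a)
  constructor
  · calc
      limsup (fun k => μk k (ball (xk k) r₁)) atTop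
          ≤ limsup (fun k => μk k (f k ⁻¹' closedBall x ((r₁ + r₂) / 2))) atTop := by
        refine limsup_le_limsup ?_
        filter_upwards [hε0.eventually_lt_const (show 0 < (r₂ - r₁) / 4 by linarith)] with k hk
        refine measure_mono fun a ha => ?_
        rw [mem_ball] at ha
        rw [mem_preimage, mem_closedBall]
        linarith [(hdist k a).2]
      _ ≤ μ (closedBall x ((r₁ + r₂) / 2)) := hclosed _ isClosed_closedBall isBounded_closedBall
      _ ≤ μ (ball x r₂) := measure_mono (closedBall_subset_ball (by linarith))
  · refine (hopen _ isOpen_ball).trans (liminf_le_liminf ?_)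
    filter_upwards [hε0.eventually_lt_const (show 0 < (r₃ - r₂) / 2 by linarith)] with k hk
    refine measure_mono fun a ha => ?_
    rw [mem_preimage, mem_ball] at ha
    rw [mem_ball]
    linarith [(hdist k a).1]
end

section
/- Let n ∈ ℕ. Let (X_k, d_k, x_k), k ∈ ℕ, be pointed metric spaces with Borel measures μ_k, and let (X, d, x) be a pointed metric space with a Borel measure μ. Assume that for all radii 0 < r < R one has limsup_{k → ∞} μ_k(B(x_k, r)) ≤ μ(B(x, R)). Then limsup_{k → ∞} ν_k(x_k) ≤ ν(x), where ν_k and ν denote the n-dimensional volume collapsing functions of (X_k, d_k, μ_k) and (X, d, μ) respectively. -/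
open MeasureTheory Metric Set Filter
open scoped ENNReal

/-- `ω_n`: the Lebesgue measure of the unit ball in `ℝⁿ`. -/
noncomputable def omegaN (n : ℕ) : ℝ≥0∞ :=
  volume (ball (0 : EuclideanSpace ℝ (Fin n)) 1)

/-- The `n`-dimensional volume collapsing function
`ν(x) = inf_{r ∈ (0,1)} μ(B(x,r)) / (ω_n rⁿ)` of a metric measure space. -/
noncomputable def volCollapse {X : Type*} [MetricSpace X] [MeasurableSpace X]
    (n : ℕ) (μ : Measure X) (x : X) : ℝ≥0∞ :=
  ⨅ r : Set.Ioo (0 : ℝ) 1, μ (ball x (r : ℝ)) / (omegaN n * ENNReal.ofReal ((r : ℝ) ^ n))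

/-- First claim of Lemma 3.4 ('LemmaVCFLimit'): under the ball-measure semicontinuity
`limsup_k μ_k(B(x_k,r)) ≤ μ(B(x,R))` for all `0 < r < R`, the volume collapsing functions
satisfy `limsup_k ν_k(x_k) ≤ ν(x)`. -/
theorem stmt_3 (n : ℕ) {X : ℕ → Type*} [∀ k, MetricSpace (X k)] [∀ k, MeasurableSpace (X k)]
    [∀ k, BorelSpace (X k)]
    {Y : Type*} [MetricSpace Y] [MeasurableSpace Y] [BorelSpace Y]
    (μk : ∀ k, Measure (X k)) (μ : Measure Y) (xk : ∀ k, X k) (x : Y)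
    (h : ∀ r R : ℝ, 0 < r → r < R →
      limsup (fun k => μk k (ball (xk k) r)) atTop ≤ μ (ball x R)) :
    limsup (fun k => volCollapse n (μk k) (xk k)) atTop ≤ volCollapse n μ x := by
  refine le_iInf fun R => ?_
  obtain ⟨R, hR0, hR1⟩ := R
  have hω0 : omegaN n ≠ 0 := (measure_ball_pos volume _ one_pos).ne'
  have hω_top : omegaN n ≠ ∞ := measure_ball_lt_top.ne
  have bound_of_lt : ∀ r, 0 < r → r < R →
      limsup (fun k => volCollapse n (μk k) (xk k)) atTop ≤
        μ (ball x R) / (omegaN n * ENNReal.ofReal (r ^ n)) := by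
    intro r hr0 hrR
    have hc0 : omegaN n * ENNReal.ofReal (r ^ n) ≠ 0 :=
      mul_ne_zero hω0 (ENNReal.ofReal_pos.2 (pow_pos hr0 n)).ne'
    calc limsup (fun k => volCollapse n (μk k) (xk k)) atTop
        ≤ limsup (fun k => (omegaN n * ENNReal.ofReal (r ^ n))⁻¹ * μk k (ball (xk k) r))
            atTop := by
          refine limsup_le_limsup (Eventually.of_forall fun k => ?_)
          dsimp only
          rw [mul_comm, ← div_eq_mul_inv]
          exact iInf_le_of_le ⟨r, hr0, hrR.trans hR1⟩ le_rfl
      _ = (omegaN n * ENNReal.ofReal (r ^ n))⁻¹ *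
            limsup (fun k => μk k (ball (xk k) r)) atTop :=
          ENNReal.limsup_const_mul_of_ne_top (ENNReal.inv_ne_top.2 hc0)
      _ ≤ μ (ball x R) / (omegaN n * ENNReal.ofReal (r ^ n)) := by
          rw [div_eq_mul_inv, mul_comm]
          gcongr
          exact h r R hr0 hrR
  have tendsto_bound : Tendsto (fun r : ℝ => μ (ball x R) / (omegaN n * ENNReal.ofReal (r ^ n)))
      (nhdsWithin R (Iio R)) (nhds (μ (ball x R) / (omegaN n * ENNReal.ofReal (R ^ n)))) := by
    refine ENNReal.Tendsto.const_div (ENNReal.Tendsto.const_mul ?_ (Or.inr hω_top))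
      (Or.inl (ENNReal.mul_ne_top hω_top ENNReal.ofReal_ne_top))
    exact (ENNReal.continuous_ofReal.comp (continuous_pow n)).continuousAt.continuousWithinAt
  refine ge_of_tendsto tendsto_bound ?_
  filter_upwards [Ioo_mem_nhdsLT hR0] with r hr using bound_of_lt r hr.1 hr.2
end

section
/- Let (X_k, d_k, x_k), k ∈ ℕ, be pointed metric spaces with Borel measures μ_k, and let (X, d, x) be a pointed metric space with a Borel measure μ, and let n ∈ ℕ. Let ε_k > 0 with ε_k → 0, and let f_k : X_k → X be Borel measurable maps such that |d(f_k(a), f_k(b)) − d_k(a,b)| ≤ ε_k for all a, b ∈ X_k and d(f_k(x_k), x) ≤ ε_k. Assume that for every open set U ⊆ X one has μ(U) ≤ liminf_k μ_k(f_k⁻¹(U)), and for every bounded closed set C ⊆ X one has limsup_k μ_k(f_k⁻¹(C)) ≤ μ(C). Then limsup_{k → ∞} ν_k(x_k) ≤ ν(x), where ν_k and ν denote the n-dimensional volume collapsing functions of (X_k, d_k, μ_k) and (X, d, μ) respectively. -/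
open MeasureTheory Metric Set Filter
open scoped ENNReal

theorem omegaN_ne_zero (n : ℕ) : omegaN n ≠ 0 :=
  (measure_ball_pos volume _ one_pos).ne'

theorem omegaN_ne_top (n : ℕ) : omegaN n ≠ ∞ :=
  measure_ball_lt_top.ne

/-- An almost isometry maps small balls into slightly larger balls. -/
theorem ball_subset_preimage_closedBall {A B : Type*} [MetricSpace A] [MetricSpace B]
    {f : A → B} {a : A} {b : B} {δ s t : ℝ}
    (hiso : ∀ p q : A, |dist (f p) (f q) - dist p q| ≤ δ) (hpt : dist (f a) b ≤ δ)
    (hst : s + 2 * δ ≤ t) : ball a s ⊆ f ⁻¹' closedBall b t := by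
  intro p hp
  have h := (abs_le.1 (hiso p a)).2
  have htri := dist_triangle (f p) (f a) b
  rw [mem_ball] at hp
  rw [mem_preimage, mem_closedBall]
  linarith

/-- First claim of Lemma 3.4 ('LemmaVCFLimit') in its measured Gromov--Hausdorff form:
if `(X_k, d_k, μ_k, x_k)` converges to `(X, d, μ, x)` in the pointed measured
Gromov--Hausdorff sense (via `ε_k`-isometries whose pushforwards converge weakly,
expressed by the portmanteau inequalities), then `limsup_k ν_k(x_k) ≤ ν(x)`. -/
theorem stmt_5 (n : ℕ) {X : ℕ → Type*} [∀ k, MetricSpace (X k)] [∀ k, MeasurableSpace (X k)]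
    [∀ k, BorelSpace (X k)]
    {Y : Type*} [MetricSpace Y] [MeasurableSpace Y] [BorelSpace Y]
    (μk : ∀ k, Measure (X k)) (μ : Measure Y) (xk : ∀ k, X k) (x : Y)
    (ε : ℕ → ℝ) (hεpos : ∀ k, 0 < ε k) (hε0 : Tendsto ε atTop (nhds 0))
    (f : ∀ k, X k → Y) (hmeas : ∀ k, Measurable (f k))
    (hiso : ∀ k, ∀ a b : X k, |dist (f k a) (f k b) - dist a b| ≤ ε k)
    (hpt : ∀ k, dist (f k (xk k)) x ≤ ε k)
    (hopen : ∀ U : Set Y, IsOpen U →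
      μ U ≤ liminf (fun k => μk k (f k ⁻¹' U)) atTop)
    (hclosed : ∀ C : Set Y, IsClosed C → Bornology.IsBounded C →
      limsup (fun k => μk k (f k ⁻¹' C)) atTop ≤ μ C) :
    limsup (fun k => volCollapse n (μk k) (xk k)) atTop ≤ volCollapse n μ x := by
  refine le_iInf fun ⟨r, hr0, hr1⟩ => ?_
  have key : ∀ s ∈ Ioo 0 r, limsup (fun k => volCollapse n (μk k) (xk k)) atTop ≤
      μ (ball x r) / (omegaN n * ENNReal.ofReal (s ^ n)) := by
    rintro s ⟨hs0, hsr⟩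
    obtain ⟨t, hst, htr⟩ := exists_between hsr
    have hc : (omegaN n * ENNReal.ofReal (s ^ n))⁻¹ ≠ ∞ :=
      ENNReal.inv_ne_top.2 (mul_ne_zero (omegaN_ne_zero n)
        (ENNReal.ofReal_pos.2 (pow_pos hs0 n)).ne')
    have hev : ∀ᶠ k in atTop, volCollapse n (μk k) (xk k) ≤
        (omegaN n * ENNReal.ofReal (s ^ n))⁻¹ * μk k (f k ⁻¹' closedBall x t) := by
      filter_upwards [hε0.eventually_lt_const (show 0 < (t - s) / 2 by linarith)] with k hk
      refine (iInf_le _ (⟨s, hs0, hsr.trans hr1⟩ : Ioo (0 : ℝ) 1)).trans ?_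
      rw [div_eq_mul_inv, mul_comm]
      gcongr
      exact ball_subset_preimage_closedBall (hiso k) (hpt k) (by linarith)
    refine (limsup_le_limsup hev).trans ?_
    rw [ENNReal.limsup_const_mul_of_ne_top hc, div_eq_mul_inv, mul_comm]
    gcongr
    exact (hclosed _ isClosed_closedBall isBounded_closedBall).trans
      (measure_mono (closedBall_subset_ball htr))
  have hlim : Tendsto (fun s : ℝ => μ (ball x r) / (omegaN n * ENNReal.ofReal (s ^ n)))
      (nhdsWithin r (Iio r)) (nhds (μ (ball x r) / (omegaN n * ENNReal.ofReal (r ^ n)))) := by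
    refine ENNReal.Tendsto.const_div (ENNReal.Tendsto.const_mul ?_ (Or.inr (omegaN_ne_top n)))
      (Or.inl (ENNReal.mul_ne_top (omegaN_ne_top n) ENNReal.ofReal_ne_top))
    exact (ENNReal.continuous_ofReal.comp (continuous_pow n)).continuousWithinAt
  exact ge_of_tendsto hlim (mem_of_superset (Ioo_mem_nhdsLT hr0) key)
end

section
/- Let (X,d) be a proper metric space and let μ be a Borel measure on X that is positive on every nonempty open set. Then for every nonempty bounded subset S ⊆ X there exists δ > 0 such that μ(B(y,1)) ≥ δ for every y ∈ S. -/
open MeasureTheory Metric Set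

/-- On a proper metric space with a Borel measure positive on every nonempty open set,
unit-ball volumes are bounded below away from zero on every nonempty bounded subset. -/
theorem stmt_8 {X : Type*} [MetricSpace X] [ProperSpace X] [MeasurableSpace X] [BorelSpace X]
    (μ : Measure X) (hpos : ∀ U : Set X, IsOpen U → U.Nonempty → 0 < μ U)
    (S : Set X) (hS : S.Nonempty) (hSb : Bornology.IsBounded S) :
    ∃ δ : ℝ, 0 < δ ∧ ∀ y ∈ S, ENNReal.ofReal δ ≤ μ (ball y 1) := by
  obtain ⟨t, ht, hSt⟩ := totallyBounded_iff.1
    (hSb.isCompact_closure.totallyBounded.subset subset_closure) (1 / 2) (by norm_num)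
  have hm : 0 < ht.toFinset.inf fun x => μ (ball x (1 / 2)) :=
    (Finset.lt_inf_iff ENNReal.zero_lt_top).2 fun x _ =>
      hpos _ isOpen_ball (nonempty_ball.2 (by norm_num))
  obtain ⟨δ, -, hδ, hδm⟩ := ENNReal.lt_iff_exists_real_btwn.1 hm
  refine ⟨δ, ENNReal.ofReal_pos.1 hδ, fun y hy => ?_⟩
  obtain ⟨x, hx, hyx⟩ := mem_iUnion₂.1 (hSt hy)
  calc ENNReal.ofReal δ ≤ μ (ball x (1 / 2)) :=
        hδm.le.trans (Finset.inf_le (ht.mem_toFinset.2 hx))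
    _ ≤ μ (ball y 1) := measure_mono <| ball_subset_ball' <| by
        rw [mem_ball'] at hyx
        linarith
end

section
/- Let M be a proper metric space, μ a finite Borel measure on M, K ⊆ M a compact subset, X a compact topological space, and h̄ : X × [0,∞) → M a continuous map such that h̄(X × {0}) ⊆ K, the restriction h of h̄ to X × (0,∞) is a homeomorphism onto M \ K, and h(X × [T,∞)) is closed in M for every T > 0. Then for every p ∈ M and every x ∈ X one has d(p, h(x,t)) → ∞ as t → ∞, and μ(B(h(x,t), 1)) → 0 as t → ∞. -/
open MeasureTheory Metric Set Filter
open scoped NNReal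

/-- For a finite Borel measure, the complements of large balls around a fixed point have
small measure. -/
theorem tendsto_measure_compl_ball_atTop {M : Type*} [PseudoMetricSpace M] [MeasurableSpace M]
    [OpensMeasurableSpace M] (μ : Measure M) [IsFiniteMeasure μ] (p : M) :
    Tendsto (fun R : ℝ => μ (ball p R)ᶜ) atTop (nhds 0) := by
  have hempty : ⋂ R : ℝ, (ball p R)ᶜ = ∅ := by
    rw [← compl_iUnion, compl_empty_iff, eq_univ_iff_forall]
    exact fun y => mem_iUnion.2 ⟨dist y p + 1, by simp⟩
  have hanti : Antitone fun R : ℝ => (ball p R)ᶜ :=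
    fun _ _ hR => compl_subset_compl.2 (ball_subset_ball hR)
  simpa [hempty, Function.comp_def] using tendsto_measure_iInter_atTop (μ := μ)
    (fun R => measurableSet_ball.compl.nullMeasurableSet) hanti ⟨0, measure_ne_top μ _⟩

/-- For a finite Borel measure, the measure of balls of fixed radius tends to zero as their
centers escape to infinity. -/
theorem tendsto_measure_ball_of_tendsto_dist_atTop {M ι : Type*} [PseudoMetricSpace M]
    [MeasurableSpace M] [OpensMeasurableSpace M] (μ : Measure M) [IsFiniteMeasure μ]
    {l : Filter ι} {c : ι → M} {p : M} (r : ℝ)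
    (hc : Tendsto (fun i => dist p (c i)) l atTop) :
    Tendsto (fun i => μ (ball (c i) r)) l (nhds 0) := by
  have hsub : Tendsto (fun i => dist p (c i) - r) l atTop :=
    tendsto_atTop_add_const_right l (-r) hc
  refine tendsto_of_tendsto_of_tendsto_of_le_of_le tendsto_const_nhds
    ((tendsto_measure_compl_ball_atTop μ p).comp hsub) (fun _ => zero_le)
    fun i => measure_mono fun y hy hy' => ?_
  rw [mem_ball] at hy hy'
  linarith [dist_triangle_left p (c i) y]

/-- If the parameter `t` is recovered continuously from `h (x, t)` off `K`, and some tail of `h`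
is closed and avoids `K`, then `h (x, t)` leaves every bounded set as `t → ∞`. -/
theorem tendsto_dist_atTop_of_isClosed_tail {M X : Type*} [PseudoMetricSpace M] [ProperSpace M]
    {K : Set M} {h : X × ℝ≥0 → M} {T : ℝ≥0} {τ : M → ℝ≥0} (hτ : ContinuousOn τ Kᶜ)
    (hτh : ∀ x, ∀ t ≥ T, τ (h (x, t)) = t) (hK : MapsTo h (univ ×ˢ Ici T) Kᶜ)
    (hclosed : IsClosed (h '' (univ ×ˢ Ici T))) (p : M) (x : X) :
    Tendsto (fun t : ℝ≥0 => dist p (h (x, t))) atTop atTop := by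
  refine tendsto_atTop.2 fun R => ?_
  have hcompact : IsCompact (closedBall p R ∩ h '' (univ ×ˢ Ici T)) :=
    (isCompact_closedBall p R).inter_right hclosed
  obtain ⟨B, hB⟩ := (hcompact.image_of_continuousOn
    (hτ.mono (inter_subset_right.trans hK.image_subset))).bddAbove
  filter_upwards [eventually_ge_atTop T, eventually_gt_atTop B] with t hT hBt
  by_contra! hlt
  refine hBt.not_ge (hB ⟨h (x, t), ⟨?_, (x, t), ⟨mem_univ _, hT⟩, rfl⟩, hτh x t hT⟩)
  rw [mem_closedBall']
  exact hlt.le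

/-- First (unnumbered) lemma of Section 4.2: for a proper finite-volume space `M` with
finitely many ends, encoded by a compact `K ⊆ M`, a compact cross-section `Xc` and a
continuous `h̄ : Xc × [0,∞) → M` restricting to a homeomorphism of `Xc × (0,∞)` onto
`M \ K` with closed tails, points `h̄(x,t)` escape to infinity and their unit-ball volumes
tend to zero as `t → ∞`. -/
theorem stmt_10 {M : Type*} [MetricSpace M] [ProperSpace M] [MeasurableSpace M] [BorelSpace M]
    (μ : Measure M) (hfin : μ Set.univ < ⊤)
    (K : Set M) (hK : IsCompact K)
    {Xc : Type*} [TopologicalSpace Xc] [CompactSpace Xc]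
    (h : Xc × ℝ≥0 → M) (hcont : Continuous h)
    (hzero : ∀ x : Xc, h (x, 0) ∈ K)
    (hbij : Set.BijOn h (Set.univ ×ˢ Set.Ioi (0 : ℝ≥0)) Kᶜ)
    (hinv : ∃ g : M → Xc × ℝ≥0, ContinuousOn g Kᶜ ∧
      ∀ p ∈ Set.univ ×ˢ Set.Ioi (0 : ℝ≥0), g (h p) = p)
    (hclosedTails : ∀ T : ℝ≥0, 0 < T → IsClosed (h '' (Set.univ ×ˢ Set.Ici T))) :
    ∀ (p : M) (x : Xc),
      Tendsto (fun t : ℝ≥0 => dist p (h (x, t))) atTop atTop ∧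
      Tendsto (fun t : ℝ≥0 => μ (ball (h (x, t)) 1)) atTop (nhds 0) := by
  intro p x
  obtain ⟨g, hg, hgh⟩ := hinv
  have : IsFiniteMeasure μ := ⟨hfin⟩
  have hdist : Tendsto (fun t : ℝ≥0 => dist p (h (x, t))) atTop atTop :=
    tendsto_dist_atTop_of_isClosed_tail (continuous_snd.comp_continuousOn hg)
      (fun y t ht => congrArg Prod.snd
        (hgh (y, t) ⟨mem_univ _, lt_of_lt_of_le one_pos ht⟩))
      (hbij.mapsTo.mono_left (prod_mono_right (Ici_subset_Ioi.2 one_pos)))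
      (hclosedTails 1 one_pos) p x
  exact ⟨hdist, tendsto_measure_ball_of_tendsto_dist_atTop μ 1 hdist⟩
end

section
/- Let M be a proper metric space, μ a finite Borel measure on M, K ⊆ M a compact subset, X a compact topological space, and h̄ : X × [0,∞) → M a continuous map such that h̄(X × {0}) ⊆ K, the restriction h of h̄ to X × (0,∞) is a homeomorphism onto M \ K, and h(X × [T,∞)) is closed in M for every T > 0. Then for every bounded subset S ⊆ M there exists T > 0 such that h(X × (T,∞)) ∩ S = ∅. -/
open MeasureTheory Metric Set Filter
open scoped NNReal

/-- For a proper finite-volume space `M` with finitely many ends (encoded by a compact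
`K ⊆ M`, a compact cross-section `Xc` and a continuous `h̄ : Xc × [0,∞) → M` restricting to
a homeomorphism of `Xc × (0,∞)` onto `M \ K` with closed tails), the tails of the ends
eventually leave every bounded region. -/
theorem stmt_11 {M : Type*} [MetricSpace M] [ProperSpace M] [MeasurableSpace M] [BorelSpace M]
    (μ : Measure M) (hfin : μ Set.univ < ⊤)
    (K : Set M) (hK : IsCompact K)
    {Xc : Type*} [TopologicalSpace Xc] [CompactSpace Xc]
    (h : Xc × ℝ≥0 → M) (hcont : Continuous h)
    (hzero : ∀ x : Xc, h (x, 0) ∈ K)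
    (hbij : Set.BijOn h (Set.univ ×ˢ Set.Ioi (0 : ℝ≥0)) Kᶜ)
    (hinv : ∃ g : M → Xc × ℝ≥0, ContinuousOn g Kᶜ ∧
      ∀ p ∈ Set.univ ×ˢ Set.Ioi (0 : ℝ≥0), g (h p) = p)
    (hclosedTails : ∀ T : ℝ≥0, 0 < T → IsClosed (h '' (Set.univ ×ˢ Set.Ici T))) :
    ∀ S : Set M, Bornology.IsBounded S →
      ∃ T : ℝ≥0, 0 < T ∧ h '' (Set.univ ×ˢ Set.Ioi T) ∩ S = ∅ := by
  intro S hS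
  obtain ⟨g, hg, hgh⟩ := hinv
  have hCK : h '' (univ ×ˢ Ici 1) ∩ closure S ⊆ Kᶜ := by
    rintro _ ⟨⟨p, hp, rfl⟩, -⟩
    exact hbij.mapsTo ⟨mem_univ _, mem_Ioi.mpr (zero_lt_one.trans_le (mem_Ici.mp hp.2))⟩
  have hC : IsCompact (h '' (univ ×ˢ Ici 1) ∩ closure S) :=
    hS.isCompact_closure.inter_left (hclosedTails 1 zero_lt_one)
  obtain ⟨B, hB⟩ := hC.bddAbove_image (continuous_snd.comp_continuousOn (hg.mono hCK))
  refine ⟨max 1 B, zero_lt_one.trans_le (le_max_left _ _), ?_⟩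
  rw [eq_empty_iff_forall_notMem]
  rintro _ ⟨⟨p, ⟨-, hp⟩, rfl⟩, hpS⟩
  obtain ⟨hp1, hpB⟩ := max_lt_iff.mp (mem_Ioi.mp hp)
  have hle := hB (mem_image_of_mem _ ⟨⟨p, ⟨mem_univ _, hp1.le⟩, rfl⟩, subset_closure hpS⟩)
  simp only [Function.comp_apply, hgh p ⟨mem_univ _, zero_lt_one.trans hp1⟩] at hle
  exact hpB.not_ge hle
end

section
/- Let M be a proper metric space, μ a finite Borel measure on M, K ⊆ M a compact subset, X a compact topological space, and h̄ : X × [0,∞) → M a continuous map such that h̄(X × {0}) ⊆ K, the restriction h of h̄ to X × (0,∞) is a homeomorphism onto M \ K, and h(X × [T,∞)) is closed in M for every T > 0. Then for every ε > 0 there exists T > 0 such that μ(B(h(x,t), 1)) ≤ ε for every x ∈ X and every t > T. -/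
open MeasureTheory Metric Set Filter
open scoped NNReal

/-- If a map on `X × [0,∞)` is injective on `X × (0,∞)` and has closed tails, then every compact
set misses some tail. -/
theorem exists_tail_disjoint {M X : Type*} [TopologicalSpace M] {h : X × ℝ≥0 → M}
    (hinj : Set.InjOn h (Set.univ ×ˢ Set.Ioi (0 : ℝ≥0)))
    (hclosed : ∀ T : ℝ≥0, 0 < T → IsClosed (h '' (Set.univ ×ˢ Set.Ici T)))
    {C : Set M} (hC : IsCompact C) :
    ∃ T : ℝ≥0, 0 < T ∧ Disjoint C (h '' (Set.univ ×ˢ Set.Ici T)) := by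
  let tail (T : Set.Ioi (0 : ℝ≥0)) : Set M := h '' (Set.univ ×ˢ Set.Ici (T : ℝ≥0))
  have hempty : C ∩ ⋂ T, tail T = ∅ := by
    refine eq_empty_of_forall_notMem fun y ⟨_, hy⟩ => ?_
    rw [mem_iInter] at hy
    obtain ⟨⟨x, t⟩, ⟨-, ht⟩, hxt⟩ := hy ⟨1, mem_Ioi.2 one_pos⟩
    obtain ⟨⟨x', t'⟩, ⟨-, ht'⟩, hxt'⟩ := hy ⟨t + 1, mem_Ioi.2 (by positivity)⟩
    have ht0 : 0 < t := one_pos.trans_le ht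
    have htt' : t < t' := (lt_add_one t).trans_le ht'
    have heq := hinj (mk_mem_prod (mem_univ x) (mem_Ioi.2 ht0))
      (mk_mem_prod (mem_univ x') (mem_Ioi.2 (ht0.trans htt'))) (hxt.trans hxt'.symm)
    exact htt'.ne (congrArg Prod.snd heq)
  have hdir : Directed (· ⊇ ·) tail := directed_of_isDirected_le fun _ _ hST =>
    image_mono (prod_mono_right (Ici_subset_Ici.2 hST))
  obtain ⟨⟨T, hT⟩, hdisj⟩ :=
    hC.elim_directed_family_closed tail (fun T => hclosed T T.2) hempty hdir
  exact ⟨T, hT, disjoint_iff_inter_eq_empty.2 hdisj⟩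

/-- First part of Lemma 4.3 ('LemmaVolEnds'): for a proper finite-volume space `M` with
finitely many ends (encoded by a compact `K ⊆ M`, a compact cross-section `Xc` and a
continuous `h̄ : Xc × [0,∞) → M` restricting to a homeomorphism of `Xc × (0,∞)` onto
`M \ K` with closed tails), for every `ε > 0` there is `T > 0` so that unit balls centered
on `Xc × (T,∞)` have volume at most `ε`. -/
theorem stmt_12 {M : Type*} [MetricSpace M] [ProperSpace M] [MeasurableSpace M] [BorelSpace M]
    (μ : Measure M) (hfin : μ Set.univ < ⊤)
    (K : Set M) (hK : IsCompact K)
    {Xc : Type*} [TopologicalSpace Xc] [CompactSpace Xc]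
    (h : Xc × ℝ≥0 → M) (hcont : Continuous h)
    (hzero : ∀ x : Xc, h (x, 0) ∈ K)
    (hbij : Set.BijOn h (Set.univ ×ˢ Set.Ioi (0 : ℝ≥0)) Kᶜ)
    (hinv : ∃ g : M → Xc × ℝ≥0, ContinuousOn g Kᶜ ∧
      ∀ p ∈ Set.univ ×ˢ Set.Ioi (0 : ℝ≥0), g (h p) = p)
    (hclosedTails : ∀ T : ℝ≥0, 0 < T → IsClosed (h '' (Set.univ ×ˢ Set.Ici T))) :
    ∀ ε : ℝ, 0 < ε → ∃ T : ℝ≥0, 0 < T ∧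
      ∀ (x : Xc) (t : ℝ≥0), T < t → μ (ball (h (x, t)) 1) ≤ ENNReal.ofReal ε := by
  intro ε hε
  have : IsFiniteMeasure μ := ⟨hfin⟩
  obtain ⟨C, hC, hCε⟩ := isTightMeasureSet_iff_exists_isCompact_measure_compl_le.1
    (isTightMeasureSet_singleton (μ := μ)) (ENNReal.ofReal ε) (ENNReal.ofReal_pos.2 hε)
  obtain ⟨T, hT, hdisj⟩ := exists_tail_disjoint hbij.injOn hclosedTails (hC.cthickening (r := 1))
  refine ⟨T, hT, fun x t ht => (measure_mono fun y hy hyC => ?_).trans (hCε μ rfl)⟩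
  refine disjoint_left.1 hdisj ?_ (mem_image_of_mem h (mk_mem_prod (mem_univ x) ht.le))
  exact mem_cthickening_of_dist_le _ y _ _ hyC (by rw [dist_comm]; exact (mem_ball.1 hy).le)
end

section
/- Let M be a proper metric space, μ a finite Borel measure on M that is positive on every nonempty open set, K ⊆ M a nonempty compact subset, X a compact topological space, and h̄ : X × [0,∞) → M a continuous map such that h̄(X × {0}) ⊆ K, the restriction h of h̄ to X × (0,∞) is a homeomorphism onto M \ K, and h(X × [T,∞)) is closed in M for every T > 0. Then for every T > 0 there exists δ > 0 such that every y ∈ M with μ(B(y,1)) ≤ δ lies in h(X × (T,∞)). -/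
open MeasureTheory Metric Set Filter
open scoped NNReal

/-- The measure of balls of a fixed radius centred in a compact set is bounded below by a positive
constant, for a measure that is positive on nonempty open sets. -/
theorem IsCompact.exists_pos_forall_lt_measure_ball {M : Type*} [PseudoMetricSpace M]
    [MeasurableSpace M] (μ : Measure M) [μ.IsOpenPosMeasure] {C : Set M} (hC : IsCompact C)
    {r : ℝ} (hr : 0 < r) :
    ∃ δ : ℝ≥0, 0 < δ ∧ ∀ y ∈ C, (δ : ENNReal) < μ (ball y r) := by
  refine hC.induction_on (p := fun s ↦ ∃ δ : ℝ≥0, 0 < δ ∧ ∀ y ∈ s, (δ : ENNReal) < μ (ball y r))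
    ⟨1, one_pos, by simp⟩ ?_ ?_ ?_
  · rintro s t hst ⟨δ, hδ, H⟩
    exact ⟨δ, hδ, fun y hy ↦ H y (hst hy)⟩
  · rintro s t ⟨δ, hδ, H⟩ ⟨ε, hε, H'⟩
    refine ⟨min δ ε, lt_min hδ hε, ?_⟩
    rintro y (hy | hy)
    · exact (ENNReal.coe_le_coe.2 (min_le_left δ ε)).trans_lt (H y hy)
    · exact (ENNReal.coe_le_coe.2 (min_le_right δ ε)).trans_lt (H' y hy)
  · intro x _
    obtain ⟨δ, hδ, hδx⟩ := ENNReal.lt_iff_exists_nnreal_btwn.1 (measure_ball_pos μ x (half_pos hr))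
    refine ⟨ball x (r / 2), mem_nhdsWithin_of_mem_nhds (ball_mem_nhds x (half_pos hr)), δ,
      ENNReal.coe_pos.1 hδ, fun y hy ↦ hδx.trans_le (measure_mono (ball_subset_ball' ?_))⟩
    rw [dist_comm]
    linarith [mem_ball.1 hy]

/-- Second part of Lemma 4.3 ('LemmaVolEnds'): for a proper finite-volume space `M` with a
measure positive on nonempty open sets and finitely many ends (encoded by a nonempty compact
`K ⊆ M`, a compact cross-section `Xc` and a continuous `h̄ : Xc × [0,∞) → M` restricting to
a homeomorphism of `Xc × (0,∞)` onto `M \ K` with closed tails), for every `T > 0` there is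
`δ > 0` so that every point whose unit ball has volume at most `δ` lies in `Xc × (T,∞)`. -/
theorem stmt_13 {M : Type*} [MetricSpace M] [ProperSpace M] [MeasurableSpace M] [BorelSpace M]
    (μ : Measure M) (hfin : μ Set.univ < ⊤)
    (hpos : ∀ U : Set M, IsOpen U → U.Nonempty → 0 < μ U)
    (K : Set M) (hK : IsCompact K) (hKne : K.Nonempty)
    {Xc : Type*} [TopologicalSpace Xc] [CompactSpace Xc]
    (h : Xc × ℝ≥0 → M) (hcont : Continuous h)
    (hzero : ∀ x : Xc, h (x, 0) ∈ K)
    (hbij : Set.BijOn h (Set.univ ×ˢ Set.Ioi (0 : ℝ≥0)) Kᶜ)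
    (hinv : ∃ g : M → Xc × ℝ≥0, ContinuousOn g Kᶜ ∧
      ∀ p ∈ Set.univ ×ˢ Set.Ioi (0 : ℝ≥0), g (h p) = p)
    (hclosedTails : ∀ T : ℝ≥0, 0 < T → IsClosed (h '' (Set.univ ×ˢ Set.Ici T))) :
    ∀ T : ℝ≥0, 0 < T → ∃ δ : ℝ, 0 < δ ∧
      ∀ y : M, μ (ball y 1) ≤ ENNReal.ofReal δ → y ∈ h '' (Set.univ ×ˢ Set.Ioi T) := by
  intro T _
  have : μ.IsOpenPosMeasure := ⟨fun U hU hne ↦ (hpos U hU hne).ne'⟩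
  have hC : IsCompact (K ∪ h '' (univ ×ˢ Icc 0 T)) :=
    hK.union ((isCompact_univ.prod isCompact_Icc).image hcont)
  obtain ⟨δ, hδ, H⟩ := hC.exists_pos_forall_lt_measure_ball μ one_pos
  refine ⟨δ, hδ, fun y hy ↦ ?_⟩
  rw [ENNReal.ofReal_coe_nnreal] at hy
  have hyC : y ∉ K ∪ h '' (univ ×ˢ Icc 0 T) := fun hmem ↦ (H y hmem).not_ge hy
  obtain ⟨p, -, rfl⟩ := hbij.surjOn fun hyK : y ∈ K ↦ hyC (Or.inl hyK)
  refine mem_image_of_mem h ⟨mem_univ _, mem_Ioi.2 (lt_of_not_ge fun hpT ↦ hyC (Or.inr ?_))⟩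
  exact mem_image_of_mem h ⟨mem_univ _, zero_le, hpT⟩
end
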